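/- Let N ≥ 3 and M ≥ 1 be integers. The map sending ⟨(a₁,b₁),(a₂,b₂)⟩⁻ to the matrix (a₁ a₂; b₁ b₂) if a₁b₂ − a₂b₁ ≡ 1 (mod N), and to (a₂ a₁; b₂ b₁) if a₁b₂ − a₂b₁ ≡ −1 (mod N), is a well-defined isomorphism of abelian groups M_{2,1}⁻ → M₂(Γ(N, MN)), with inverse given by (a b; c d) ↦ ⟨(a,c),(b,d)⟩⁻. -/

import Mathlib

/-- The set of `n`-tuples of elements of `A` which generate `A`. -/
def GenTuple (n : ℕ) (A : Type) [AddCommGroup A] : Type :=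
  {b : Fin n → A // AddSubgroup.closure (Set.range b) = ⊤}

/-- The determinant (mod `N`) of a pair of characters of `ℤ/N × ℤ/MN`:
for `β = ((a₁,b₁),(a₂,b₂))` it is `a₁b₂ - a₂b₁ ∈ ℤ/N`. -/
def detp (N M : ℕ) (β : GenTuple 2 (ZMod N × ZMod (M*N))) : ZMod N :=
  (β.1 0).1 * ZMod.castHom (dvd_mul_left N M) (ZMod N) (β.1 1).2
    - (β.1 1).1 * ZMod.castHom (dvd_mul_left N M) (ZMod N) (β.1 0).2

open FreeAbelianGroup

namespace KPT2

variable (N M : ℕ)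

/-- The set `S_{2,k} ∪ S_{2,-k}`: generating pairs of `ℤ/N × ℤ/MN` with
determinant `± k`. -/
def Tk (k : (ZMod N)ˣ) : Type :=
  {β : GenTuple 2 (ZMod N × ZMod (M*N)) //
    detp N M β = (k : ZMod N) ∨ detp N M β = -(k : ZMod N)}

/-- The reordering relation (O) on symbols of determinant `±k`. -/
def relOk (k : (ZMod N)ˣ) : Set (FreeAbelianGroup (Tk N M k)) :=
  {x | ∃ β β' : Tk N M k,
    β'.1.1 0 = β.1.1 1 ∧ β'.1.1 1 = β.1.1 0 ∧ x = of β - of β'}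

/-- The motivic blowup relation (M) on symbols of determinant `±k`. -/
def relMk (k : (ZMod N)ˣ) : Set (FreeAbelianGroup (Tk N M k)) :=
  {x | ∃ β β₁ β₂ : Tk N M k,
    β₁.1.1 0 = β.1.1 0 - β.1.1 1 ∧ β₁.1.1 1 = β.1.1 1 ∧
    β₂.1.1 0 = β.1.1 0 ∧ β₂.1.1 1 = β.1.1 1 - β.1.1 0 ∧
    x = of β - of β₁ - of β₂}

/-- The anti-symmetry relation (A) on symbols of determinant `±k`. -/
def relAk (k : (ZMod N)ˣ) : Set (FreeAbelianGroup (Tk N M k)) :=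
  {x | ∃ β β' : Tk N M k,
    β'.1.1 0 = -β.1.1 0 ∧ β'.1.1 1 = β.1.1 1 ∧ x = of β + of β'}

/-- The group `M⁻_{2,k}(ℤ/N × ℤ/MN)`. -/
def M2kMinus (k : (ZMod N)ˣ) : Type :=
  FreeAbelianGroup (Tk N M k) ⧸
    AddSubgroup.closure (relOk N M k ∪ relMk N M k ∪ relAk N M k)

instance (k : (ZMod N)ˣ) : AddCommGroup (M2kMinus N M k) :=
  QuotientAddGroup.Quotient.addCommGroup _

/-- The symbol `⟨(a₁,b₁),(a₂,b₂)⟩⁻ ∈ M⁻_{2,k}`. -/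
def symb2k (k : (ZMod N)ˣ) (β : Tk N M k) : M2kMinus N M k :=
  QuotientAddGroup.mk (of β)

end KPT2

open FreeAbelianGroup

namespace KPT2

variable (N M : ℕ)

/-- The set `S_{2,1}`: generating pairs of `ℤ/N × ℤ/MN` of determinant `1`. -/
def T1 : Type := {β : GenTuple 2 (ZMod N × ZMod (M*N)) // detp N M β = 1}

/-- The Manin relation (R1): `(a b; c d) = -(b -a; d -c)`. -/
def relR1 : Set (FreeAbelianGroup (T1 N M)) :=
  {x | ∃ β β' : T1 N M,
    β'.1.1 0 = β.1.1 1 ∧ β'.1.1 1 = -β.1.1 0 ∧ x = of β + of β'}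

/-- The Manin relation (R2): `(a b; c d) = (a-b b; c-d d) + (a b-a; c d-c)`. -/
def relR2 : Set (FreeAbelianGroup (T1 N M)) :=
  {x | ∃ β β₁ β₂ : T1 N M,
    β₁.1.1 0 = β.1.1 0 - β.1.1 1 ∧ β₁.1.1 1 = β.1.1 1 ∧
    β₂.1.1 0 = β.1.1 0 ∧ β₂.1.1 1 = β.1.1 1 - β.1.1 0 ∧
    x = of β - of β₁ - of β₂}

/-- The space of Manin modular symbols `𝕄₂(Γ(N, MN))`. -/
def ManinM2 : Type :=
  FreeAbelianGroup (T1 N M) ⧸ AddSubgroup.closure (relR1 N M ∪ relR2 N M)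

instance : AddCommGroup (ManinM2 N M) := QuotientAddGroup.Quotient.addCommGroup _

/-- The Manin symbol `(a b; c d) ∈ 𝕄₂(Γ(N, MN))`. -/
def symbManin (β : T1 N M) : ManinM2 N M := QuotientAddGroup.mk (of β)

end KPT2

namespace KPT2

variable {N M : ℕ}

lemma GenTuple.ext_two {A : Type} [AddCommGroup A] {β γ : GenTuple 2 A}
    (h0 : β.1 0 = γ.1 0) (h1 : β.1 1 = γ.1 1) : β = γ :=
  Subtype.ext (funext (Fin.forall_fin_two.2 ⟨h0, h1⟩))

/-- Exchange the two members of a generating pair. -/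
def swapPair {A : Type} [AddCommGroup A] (β : GenTuple 2 A) : GenTuple 2 A :=
  ⟨β.1 ∘ Equiv.swap 0 1, by rw [(Equiv.swap (0 : Fin 2) 1).surjective.range_comp]; exact β.2⟩

@[simp] lemma swapPair_zero {A : Type} [AddCommGroup A] (β : GenTuple 2 A) :
    (swapPair β).1 0 = β.1 1 := by
  simp [swapPair]

@[simp] lemma swapPair_one {A : Type} [AddCommGroup A] (β : GenTuple 2 A) :
    (swapPair β).1 1 = β.1 0 := by
  simp [swapPair]

lemma detp_of_swap {β γ : GenTuple 2 (ZMod N × ZMod (M * N))}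
    (h0 : γ.1 0 = β.1 1) (h1 : γ.1 1 = β.1 0) : detp N M γ = -detp N M β := by
  simp only [detp, h0, h1]; ring

lemma detp_swapPair (β : GenTuple 2 (ZMod N × ZMod (M * N))) :
    detp N M (swapPair β) = -detp N M β :=
  detp_of_swap (swapPair_zero β) (swapPair_one β)

lemma detp_of_neg_left {β γ : GenTuple 2 (ZMod N × ZMod (M * N))}
    (h0 : γ.1 0 = -β.1 0) (h1 : γ.1 1 = β.1 1) : detp N M γ = -detp N M β := by
  simp only [detp, h0, h1, Prod.fst_neg, Prod.snd_neg, map_neg]; ring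

lemma detp_of_sub_left {β γ : GenTuple 2 (ZMod N × ZMod (M * N))}
    (h0 : γ.1 0 = β.1 0 - β.1 1) (h1 : γ.1 1 = β.1 1) : detp N M γ = detp N M β := by
  simp only [detp, h0, h1, Prod.fst_sub, Prod.snd_sub, map_sub]; ring

lemma detp_of_sub_right {β γ : GenTuple 2 (ZMod N × ZMod (M * N))}
    (h0 : γ.1 0 = β.1 0) (h1 : γ.1 1 = β.1 1 - β.1 0) : detp N M γ = detp N M β := by
  simp only [detp, h0, h1, Prod.fst_sub, Prod.snd_sub, map_sub]; ring

lemma T1.ext {β γ : T1 N M} (h0 : β.1.1 0 = γ.1.1 0) (h1 : β.1.1 1 = γ.1.1 1) : β = γ :=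
  Subtype.ext (GenTuple.ext_two h0 h1)

lemma Tk.detp_eq_neg_one (β : Tk N M 1) (h : detp N M β.1 ≠ 1) : detp N M β.1 = -1 :=
  β.2.resolve_left h

lemma symbManin_R1 {β β' : T1 N M} (h0 : β'.1.1 0 = β.1.1 1) (h1 : β'.1.1 1 = -β.1.1 0) :
    symbManin N M β + symbManin N M β' = 0 :=
  (QuotientAddGroup.eq_zero_iff (of β + of β')).2
    (AddSubgroup.subset_closure (Or.inl ⟨β, β', h0, h1, rfl⟩))

lemma symbManin_R2 {β β₁ β₂ : T1 N M}
    (h₁0 : β₁.1.1 0 = β.1.1 0 - β.1.1 1) (h₁1 : β₁.1.1 1 = β.1.1 1)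
    (h₂0 : β₂.1.1 0 = β.1.1 0) (h₂1 : β₂.1.1 1 = β.1.1 1 - β.1.1 0) :
    symbManin N M β - symbManin N M β₁ - symbManin N M β₂ = 0 :=
  (QuotientAddGroup.eq_zero_iff (of β - of β₁ - of β₂)).2
    (AddSubgroup.subset_closure (Or.inr ⟨β, β₁, β₂, h₁0, h₁1, h₂0, h₂1, rfl⟩))

lemma symb2k_O {k : (ZMod N)ˣ} {β β' : Tk N M k}
    (h0 : β'.1.1 0 = β.1.1 1) (h1 : β'.1.1 1 = β.1.1 0) :
    symb2k N M k β = symb2k N M k β' :=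
  sub_eq_zero.1 <| (QuotientAddGroup.eq_zero_iff (of β - of β')).2
    (AddSubgroup.subset_closure (Or.inl (Or.inl ⟨β, β', h0, h1, rfl⟩)))

lemma symb2k_M {k : (ZMod N)ˣ} {β β₁ β₂ : Tk N M k}
    (h₁0 : β₁.1.1 0 = β.1.1 0 - β.1.1 1) (h₁1 : β₁.1.1 1 = β.1.1 1)
    (h₂0 : β₂.1.1 0 = β.1.1 0) (h₂1 : β₂.1.1 1 = β.1.1 1 - β.1.1 0) :
    symb2k N M k β - symb2k N M k β₁ - symb2k N M k β₂ = 0 :=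
  (QuotientAddGroup.eq_zero_iff (of β - of β₁ - of β₂)).2
    (AddSubgroup.subset_closure (Or.inl (Or.inr ⟨β, β₁, β₂, h₁0, h₁1, h₂0, h₂1, rfl⟩)))

lemma symb2k_A {k : (ZMod N)ˣ} {β β' : Tk N M k}
    (h0 : β'.1.1 0 = -β.1.1 0) (h1 : β'.1.1 1 = β.1.1 1) :
    symb2k N M k β + symb2k N M k β' = 0 :=
  (QuotientAddGroup.eq_zero_iff (of β + of β')).2
    (AddSubgroup.subset_closure (Or.inr ⟨β, β', h0, h1, rfl⟩))

lemma M2kMinus.hom_ext {k : (ZMod N)ˣ} {G : Type} [AddCommGroup G] {f g : M2kMinus N M k →+ G}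
    (h : ∀ β, f (symb2k N M k β) = g (symb2k N M k β)) : f = g :=
  QuotientAddGroup.addMonoidHom_ext _ (FreeAbelianGroup.lift_ext _ _ h)

lemma ManinM2.hom_ext {G : Type} [AddCommGroup G] {f g : ManinM2 N M →+ G}
    (h : ∀ β, f (symbManin N M β) = g (symbManin N M β)) : f = g :=
  QuotientAddGroup.addMonoidHom_ext _ (FreeAbelianGroup.lift_ext _ _ h)

open Classical in
/-- The Manin symbol of a pair of determinant `±1`, reordered to have determinant `1`. -/
noncomputable def orientedSymb (β : Tk N M 1) : ManinM2 N M :=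
  if h : detp N M β.1 = 1 then symbManin N M ⟨β.1, h⟩
  else symbManin N M ⟨swapPair β.1, by rw [detp_swapPair, β.detp_eq_neg_one h, neg_neg]⟩

lemma orientedSymb_of_eq {β : Tk N M 1} (h : detp N M β.1 = 1) :
    orientedSymb β = symbManin N M ⟨β.1, h⟩ :=
  dif_pos h

lemma neg_one_ne_one_of_three_le (hN : 3 ≤ N) : (-1 : ZMod N) ≠ 1 :=
  haveI : Fact (2 < N) := ⟨hN⟩
  ZMod.neg_one_ne_one

lemma orientedSymb_of_swap (hN : 3 ≤ N) {β : Tk N M 1} (h : detp N M β.1 = -1) {β' : T1 N M}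
    (h0 : β'.1.1 0 = β.1.1 1) (h1 : β'.1.1 1 = β.1.1 0) :
    orientedSymb β = symbManin N M β' := by
  rw [orientedSymb, dif_neg (h.trans_ne (neg_one_ne_one_of_three_le hN))]
  exact congrArg _ (T1.ext (by simp [h0]) (by simp [h1]))

lemma orientedSymb_O (hN : 3 ≤ N) {β β' : Tk N M 1}
    (h0 : β'.1.1 0 = β.1.1 1) (h1 : β'.1.1 1 = β.1.1 0) :
    orientedSymb β = orientedSymb β' := by
  have hd := detp_of_swap h0 h1
  by_cases h : detp N M β.1 = 1
  · rw [orientedSymb_of_eq h]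
    exact (orientedSymb_of_swap hN (by rw [hd, h]) h1.symm h0.symm).symm
  · have h' := β.detp_eq_neg_one h
    rw [orientedSymb_of_eq (show detp N M β'.1 = 1 by rw [hd, h', neg_neg])]
    exact orientedSymb_of_swap hN h' h0 h1

lemma orientedSymb_M (hN : 3 ≤ N) {β β₁ β₂ : Tk N M 1}
    (h₁0 : β₁.1.1 0 = β.1.1 0 - β.1.1 1) (h₁1 : β₁.1.1 1 = β.1.1 1)
    (h₂0 : β₂.1.1 0 = β.1.1 0) (h₂1 : β₂.1.1 1 = β.1.1 1 - β.1.1 0) :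
    orientedSymb β - orientedSymb β₁ - orientedSymb β₂ = 0 := by
  have hd₁ := detp_of_sub_left h₁0 h₁1
  have hd₂ := detp_of_sub_right h₂0 h₂1
  by_cases h : detp N M β.1 = 1
  · rw [orientedSymb_of_eq h, orientedSymb_of_eq (hd₁.trans h), orientedSymb_of_eq (hd₂.trans h)]
    exact symbManin_R2 h₁0 h₁1 h₂0 h₂1
  · have h' := β.detp_eq_neg_one h
    have swap_eq (γ : Tk N M 1) (hγ : detp N M γ.1 = -1) :
        orientedSymb γ = symbManin N M ⟨swapPair γ.1, by rw [detp_swapPair, hγ, neg_neg]⟩ :=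
      orientedSymb_of_swap hN hγ (swapPair_zero _) (swapPair_one _)
    rw [swap_eq β h', swap_eq β₁ (hd₁.trans h'), swap_eq β₂ (hd₂.trans h'), sub_right_comm]
    apply symbManin_R2 <;> simp [h₁0, h₁1, h₂0, h₂1]

lemma orientedSymb_A (hN : 3 ≤ N) {β β' : Tk N M 1}
    (h0 : β'.1.1 0 = -β.1.1 0) (h1 : β'.1.1 1 = β.1.1 1) :
    orientedSymb β + orientedSymb β' = 0 := by
  have hd := detp_of_neg_left h0 h1
  by_cases h : detp N M β.1 = 1
  · have h' : detp N M β'.1 = -1 := by rw [hd, h]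
    rw [orientedSymb_of_eq h, orientedSymb_of_swap hN h'
      (β' := ⟨swapPair β'.1, by rw [detp_swapPair, h', neg_neg]⟩)
      (swapPair_zero _) (swapPair_one _)]
    apply symbManin_R1 <;> simp [h0, h1]
  · have h' := β.detp_eq_neg_one h
    rw [orientedSymb_of_eq (show detp N M β'.1 = 1 by rw [hd, h', neg_neg]),
      orientedSymb_of_swap hN h' (β' := ⟨swapPair β.1, by rw [detp_swapPair, h', neg_neg]⟩)
      (swapPair_zero _) (swapPair_one _), add_comm]
    apply symbManin_R1 <;> simp [h0, h1]

/-- The homomorphism `M⁻_{2,1} → 𝕄₂(Γ(N, MN))` reordering symbols to determinant `1`. -/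
noncomputable def toManin (hN : 3 ≤ N) : M2kMinus N M 1 →+ ManinM2 N M :=
  QuotientAddGroup.lift _ (FreeAbelianGroup.lift orientedSymb) <| by
    rw [AddSubgroup.closure_le]
    rintro _ ((⟨β, β', h0, h1, rfl⟩ | ⟨β, β₁, β₂, h₁0, h₁1, h₂0, h₂1, rfl⟩) |
      ⟨β, β', h0, h1, rfl⟩)
    · simp [AddMonoidHom.mem_ker, orientedSymb_O hN h0 h1]
    · simp [AddMonoidHom.mem_ker, orientedSymb_M hN h₁0 h₁1 h₂0 h₂1]
    · simp [AddMonoidHom.mem_ker, orientedSymb_A hN h0 h1]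

lemma toManin_symb2k (hN : 3 ≤ N) (β : Tk N M 1) :
    toManin hN (symb2k N M 1 β) = orientedSymb β :=
  FreeAbelianGroup.lift_apply_of orientedSymb β

/-- A pair of determinant `1`, regarded as a pair of determinant `±1`. -/
def T1.toTk (β : T1 N M) : Tk N M 1 := ⟨β.1, Or.inl β.2⟩

lemma symb2k_R1 {β β' : T1 N M} (h0 : β'.1.1 0 = β.1.1 1) (h1 : β'.1.1 1 = -β.1.1 0) :
    symb2k N M 1 β.toTk + symb2k N M 1 β'.toTk = 0 := by
  let γ : Tk N M 1 := ⟨swapPair β'.1, Or.inr (by rw [detp_swapPair, β'.2]; rfl)⟩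
  rw [symb2k_O (β := β'.toTk) (β' := γ) (swapPair_zero _) (swapPair_one _)]
  exact symb2k_A ((swapPair_zero _).trans h1) ((swapPair_one _).trans h0)

/-- The homomorphism `𝕄₂(Γ(N, MN)) → M⁻_{2,1}`, `(a b; c d) ↦ ⟨(a,c),(b,d)⟩⁻`. -/
def ofManin : ManinM2 N M →+ M2kMinus N M 1 :=
  QuotientAddGroup.lift _ (FreeAbelianGroup.lift fun β : T1 N M ↦ symb2k N M 1 β.toTk) <| by
    rw [AddSubgroup.closure_le]
    rintro _ (⟨β, β', h0, h1, rfl⟩ | ⟨β, β₁, β₂, h₁0, h₁1, h₂0, h₂1, rfl⟩)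
    · simp [AddMonoidHom.mem_ker, symb2k_R1 h0 h1]
    · simpa [AddMonoidHom.mem_ker] using
        symb2k_M (β := β.toTk) (β₁ := β₁.toTk) (β₂ := β₂.toTk) h₁0 h₁1 h₂0 h₂1

lemma ofManin_symbManin (β : T1 N M) : ofManin (symbManin N M β) = symb2k N M 1 β.toTk :=
  FreeAbelianGroup.lift_apply_of (fun β : T1 N M ↦ symb2k N M 1 β.toTk) β

lemma ofManin_comp_toManin (hN : 3 ≤ N) :
    (ofManin (N := N) (M := M)).comp (toManin hN) = AddMonoidHom.id _ := by
  refine M2kMinus.hom_ext fun β ↦ ?_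
  rw [AddMonoidHom.comp_apply, toManin_symb2k, AddMonoidHom.id_apply]
  by_cases h : detp N M β.1 = 1
  · rw [orientedSymb_of_eq h]
    exact ofManin_symbManin ⟨β.1, h⟩
  · have h' := β.detp_eq_neg_one h
    rw [orientedSymb_of_swap hN h' (β' := ⟨swapPair β.1, by rw [detp_swapPair, h', neg_neg]⟩)
      (swapPair_zero _) (swapPair_one _)]
    exact (ofManin_symbManin _).trans (symb2k_O (swapPair_zero _) (swapPair_one _)).symm

lemma toManin_comp_ofManin (hN : 3 ≤ N) :
    (toManin hN).comp (ofManin (N := N) (M := M)) = AddMonoidHom.id _ := by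
  refine ManinM2.hom_ext fun β ↦ ?_
  rw [AddMonoidHom.comp_apply, ofManin_symbManin, toManin_symb2k, AddMonoidHom.id_apply]
  exact orientedSymb_of_eq β.2

end KPT2

open KPT2 in
theorem statement_8 (N M : ℕ) (hN : 3 ≤ N) (hM : 1 ≤ M) :
    ∃ e : M2kMinus N M 1 ≃+ ManinM2 N M,
      -- symbols of determinant `1` map to the same matrix
      (∀ (β : Tk N M 1) (h : detp N M β.1 = 1),
        e (symb2k N M 1 β) = symbManin N M ⟨β.1, h⟩) ∧
      -- symbols of determinant `-1` map to the matrix with the columns swapped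
      (∀ (β : Tk N M 1) (_ : detp N M β.1 = -1) (β' : T1 N M),
        β'.1.1 0 = β.1.1 1 → β'.1.1 1 = β.1.1 0 →
        e (symb2k N M 1 β) = symbManin N M β') ∧
      -- the inverse is `(a b; c d) ↦ ⟨(a,c),(b,d)⟩⁻`
      (∀ β : T1 N M,
        e.symm (symbManin N M β) = symb2k N M 1 ⟨β.1, Or.inl β.2⟩) := by
  refine ⟨(toManin hN).toAddEquiv ofManin (ofManin_comp_toManin hN) (toManin_comp_ofManin hN),
    fun β h ↦ ?_, fun β h β' h0 h1 ↦ ?_, fun β ↦ ofManin_symbManin β⟩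
  · exact (toManin_symb2k hN β).trans (orientedSymb_of_eq h)
  · exact (toManin_symb2k hN β).trans (orientedSymb_of_swap hN h h0 h1)
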